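/- With the q-quadratic lattice, the operators D_x, S_x, and the notion of regular functional as in the context, suppose u is a regular ℂ-linear functional on complex polynomials with monic OPS (P_n), and suppose u satisfies the Pearson equation u(φ·D_xf) + u(ψ·S_xf) = 0 for all polynomials f, where deg φ ≤ 2, deg ψ ≤ 1, (φ,ψ) ≠ (0,0). Then: (i) (φ,ψ) is x-admissible, i.e. d_n := (γ_n/2)φ″ + α_nψ′ ≠ 0 for every n ≥ 0; and (ii) for every k ≥ 1, the functional u^{[k]} (defined recursively in the context) is regular and the monic polynomials P_n^{[k]} := (γ_n!/γ_{n+k}!)·D_x^k P_{n+k} form the monic OPS with respect to u^{[k]}, i.e. u^{[k]}(P_n^{[k]}·P_m^{[k]}) = 0 for n ≠ m and u^{[k]}((P_n^{[k]})²) ≠ 0 for all n. -/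

import Mathlib

open Polynomial

noncomputable def qp (q : ℝ) (t : ℂ) : ℂ := Complex.exp (t * (Real.log q : ℂ))

noncomputable def alphaL (q : ℝ) : ℂ := (qp q (1/2) + qp q (-(1/2))) / 2

noncomputable def alphaN (q : ℝ) (n : ℕ) : ℂ :=
  (qp q ((n : ℂ) / 2) + qp q (-((n : ℂ) / 2))) / 2

noncomputable def gammaN (q : ℝ) (n : ℕ) : ℂ :=
  (qp q ((n : ℂ) / 2) - qp q (-((n : ℂ) / 2))) / (qp q (1/2) - qp q (-(1/2)))

noncomputable def latX (q : ℝ) (c1 c2 c3 s : ℂ) : ℂ := c1 * qp q (-s) + c2 * qp q s + c3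

noncomputable def U1L (q : ℝ) (c3 : ℂ) : Polynomial ℂ :=
  Polynomial.C (alphaL q ^ 2 - 1) * (Polynomial.X - Polynomial.C c3)

noncomputable def U2L (q : ℝ) (c1 c2 c3 : ℂ) : Polynomial ℂ :=
  Polynomial.C (alphaL q ^ 2 - 1) *
    ((Polynomial.X - Polynomial.C c3) ^ 2 - Polynomial.C (4 * c1 * c2))

noncomputable def gammaFact (q : ℝ) : ℕ → ℂ
  | 0 => 1
  | n + 1 => gammaFact q n * gammaN q (n + 1)

theorem qp_add (q : ℝ) (s t : ℂ) : qp q (s + t) = qp q s * qp q t := by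
  simp only [qp, add_mul, Complex.exp_add]

theorem qp_neg (q : ℝ) (t : ℂ) : qp q (-t) = (qp q t)⁻¹ := by
  simp only [qp, neg_mul, Complex.exp_neg]

theorem qp_ne_zero (q : ℝ) (t : ℂ) : qp q t ≠ 0 := Complex.exp_ne_zero _

theorem qp_natCast_div_two (q : ℝ) (n : ℕ) : qp q ((n : ℂ) / 2) = qp q (1 / 2) ^ n := by
  simp only [qp, ← Complex.exp_nat_mul]
  ring_nf

theorem qp_half_eq_ofReal (q : ℝ) : qp q (1 / 2) = ((Real.exp (Real.log q / 2) : ℝ) : ℂ) := by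
  rw [qp, Complex.ofReal_exp]
  push_cast
  ring_nf

theorem qp_half_pow_sub_inv_ne_zero {q : ℝ} (hq : 0 < q) (hq1 : q ≠ 1) (n : ℕ) :
    qp q (1 / 2) ^ (n + 1) - (qp q (1 / 2) ^ (n + 1))⁻¹ ≠ 0 := by
  have hpos := Real.exp_pos (Real.log q / 2)
  have hne : Real.exp (Real.log q / 2) ≠ 1 := by
    rw [Ne, Real.exp_eq_one_iff]
    have := Real.log_ne_zero_of_pos_of_ne_one hq hq1
    simpa using this
  rw [qp_half_eq_ofReal]
  generalize Real.exp (Real.log q / 2) = p at hpos hne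
  intro h0
  have h1 : p ^ (n + 1) - (p ^ (n + 1))⁻¹ = 0 := by exact_mod_cast h0
  have h2 : p ^ (n + 1) ≠ 0 := (pow_pos hpos _).ne'
  have h3 : (p ^ (n + 1)) ^ 2 = 1 := by
    field_simp at h1
    linarith
  rw [← pow_mul] at h3
  exact hne ((pow_eq_one_iff_of_nonneg hpos.le (by simp)).1 h3)

theorem qp_half_sub_inv_ne_zero {q : ℝ} (hq : 0 < q) (hq1 : q ≠ 1) :
    qp q (1 / 2) - (qp q (1 / 2))⁻¹ ≠ 0 := by
  simpa using qp_half_pow_sub_inv_ne_zero hq hq1 0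

theorem alphaL_ne_zero (q : ℝ) : alphaL q ≠ 0 := by
  rw [alphaL, qp_neg, qp_half_eq_ofReal]
  have hpos := Real.exp_pos (Real.log q / 2)
  generalize Real.exp (Real.log q / 2) = p at hpos
  have : (p + p⁻¹) / 2 ≠ 0 := by positivity
  exact_mod_cast this

theorem alphaL_sq_sub_one_ne_zero {q : ℝ} (hq : 0 < q) (hq1 : q ≠ 1) :
    alphaL q ^ 2 - 1 ≠ 0 := by
  have h := qp_half_sub_inv_ne_zero hq hq1
  have h0 := qp_ne_zero q (1 / 2)
  have : alphaL q ^ 2 - 1 = ((qp q (1 / 2) - (qp q (1 / 2))⁻¹) / 2) ^ 2 := by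
    rw [alphaL, qp_neg]
    field_simp
    ring
  rw [this]
  exact pow_ne_zero _ (div_ne_zero h two_ne_zero)

theorem alphaN_eq (q : ℝ) (n : ℕ) :
    alphaN q n = (qp q (1 / 2) ^ n + (qp q (1 / 2) ^ n)⁻¹) / 2 := by
  rw [alphaN, qp_neg, qp_natCast_div_two]

theorem gammaN_eq (q : ℝ) (n : ℕ) :
    gammaN q n = (qp q (1 / 2) ^ n - (qp q (1 / 2) ^ n)⁻¹) / (qp q (1 / 2) - (qp q (1 / 2))⁻¹) := by
  rw [gammaN, qp_neg, qp_neg, qp_natCast_div_two]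

@[simp]
theorem alphaN_zero (q : ℝ) : alphaN q 0 = 1 := by simp [alphaN_eq]

@[simp]
theorem gammaN_zero (q : ℝ) : gammaN q 0 = 0 := by simp [gammaN_eq]

theorem gammaN_succ_ne_zero {q : ℝ} (hq : 0 < q) (hq1 : q ≠ 1) (n : ℕ) : gammaN q (n + 1) ≠ 0 := by
  rw [gammaN_eq]
  exact div_ne_zero (qp_half_pow_sub_inv_ne_zero hq hq1 n) (qp_half_sub_inv_ne_zero hq hq1)

theorem gammaN_succ {q : ℝ} (hq : 0 < q) (hq1 : q ≠ 1) (n : ℕ) :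
    gammaN q (n + 1) = alphaN q n + alphaL q * gammaN q n := by
  have h := qp_half_sub_inv_ne_zero hq hq1
  have h0 := qp_ne_zero q (1 / 2)
  rw [gammaN_eq, gammaN_eq, alphaN_eq, alphaL, qp_neg]
  generalize qp q (1 / 2) = p at h h0
  have h1 : p ^ n ≠ 0 := pow_ne_zero n h0
  rw [pow_succ]
  generalize p ^ n = r at h1
  rw [mul_div_assoc', div_eq_iff h, add_mul, div_mul_cancel₀ _ h]
  field_simp
  ring

theorem alphaN_succ {q : ℝ} (hq : 0 < q) (hq1 : q ≠ 1) (n : ℕ) :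
    alphaN q (n + 1) = alphaL q * alphaN q n + (alphaL q ^ 2 - 1) * gammaN q n := by
  have h := qp_half_sub_inv_ne_zero hq hq1
  have h0 := qp_ne_zero q (1 / 2)
  have h3 : alphaL q ^ 2 - 1 = (qp q (1 / 2) - (qp q (1 / 2))⁻¹) ^ 2 / 4 := by
    rw [alphaL, qp_neg]
    field_simp
    ring
  have h2 : (alphaL q ^ 2 - 1) * gammaN q n =
      (qp q (1 / 2) - (qp q (1 / 2))⁻¹) / 4 * (qp q (1 / 2) ^ n - (qp q (1 / 2) ^ n)⁻¹) := by
    rw [gammaN_eq, h3]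
    generalize qp q (1 / 2) - (qp q (1 / 2))⁻¹ = t at h
    field_simp
  rw [h2, alphaN_eq, alphaN_eq, alphaL, qp_neg]
  generalize qp q (1 / 2) = p at h0
  have h1 : p ^ n ≠ 0 := pow_ne_zero n h0
  rw [pow_succ]
  generalize p ^ n = r at h1
  field_simp
  ring

theorem gammaFact_ne_zero {q : ℝ} (hq : 0 < q) (hq1 : q ≠ 1) (n : ℕ) : gammaFact q n ≠ 0 := by
  induction n with
  | zero => simp [gammaFact]
  | succ n ih => exact mul_ne_zero ih (gammaN_succ_ne_zero hq hq1 n)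

/-- The algebraic rules obeyed by the divided difference operator `D` and the averaging operator
`S` of the `q`-quadratic lattice. -/
structure IsDividedDifferencePair (q : ℝ) (c1 c2 c3 : ℂ) (D S : ℂ[X] → ℂ[X]) : Prop where
  D_add : ∀ f g, D (f + g) = D f + D g
  S_add : ∀ f g, S (f + g) = S f + S g
  D_C : ∀ a, D (C a) = 0
  S_C : ∀ a, S (C a) = C a
  D_X : D X = 1
  S_X : S X = C (alphaL q) * (X - C c3) + C c3
  D_mul : ∀ f g, D (f * g) = D f * S g + S f * D g
  S_mul : ∀ f g, S (f * g) = S f * S g + U2L q c1 c2 c3 * (D f * D g)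

/-- `P` is the monic orthogonal polynomial sequence of the linear functional `v`. -/
structure IsMonicOPS (v : ℂ[X] →ₗ[ℂ] ℂ) (P : ℕ → ℂ[X]) : Prop where
  monic : ∀ n, (P n).Monic
  natDegree_eq : ∀ n, (P n).natDegree = n
  ortho : ∀ n m, n ≠ m → v (P n * P m) = 0
  norm_ne : ∀ n, v (P n * P n) ≠ 0

section Lattice

theorem exists_latX_eq {q : ℝ} (hq : 0 < q) (hq1 : q ≠ 1) {c1 c2 : ℂ} (hc : c1 * c2 ≠ 0)
    (c3 x : ℂ) : ∃ s, latX q c1 c2 c3 s = x := by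
  have hc1 : c1 ≠ 0 := left_ne_zero_of_mul hc
  have hc2 : c2 ≠ 0 := right_ne_zero_of_mul hc
  obtain ⟨r, hr⟩ := IsAlgClosed.exists_pow_nat_eq ((x - c3) ^ 2 - 4 * c1 * c2) (n := 2) (by norm_num)
  have hz : x - c3 + r ≠ 0 := by
    intro h
    have : r = -(x - c3) := by linear_combination h
    rw [this] at hr
    exact hc (by linear_combination hr / 4)
  obtain ⟨t, ht⟩ : ∃ t, Complex.exp t = (x - c3 + r) / (2 * c2) :=
    ⟨_, Complex.exp_log (div_ne_zero hz (mul_ne_zero two_ne_zero hc2))⟩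
  have hl : (Real.log q : ℂ) ≠ 0 := by
    exact_mod_cast Real.log_ne_zero_of_pos_of_ne_one hq hq1
  refine ⟨t / Real.log q, ?_⟩
  rw [latX, qp_neg, qp, div_mul_cancel₀ _ hl, ht]
  field_simp
  linear_combination hr

theorem latX_add_half (q : ℝ) (c1 c2 c3 s : ℂ) : latX q c1 c2 c3 (s + 1 / 2) =
    (alphaL q * (latX q c1 c2 c3 s - c3) + c3) +
      (qp q (1 / 2) - qp q (-(1 / 2))) / 2 * (c2 * qp q s - c1 * qp q (-s)) := by
  simp only [latX, alphaL, neg_add, qp_add]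
  ring

theorem latX_sub_half (q : ℝ) (c1 c2 c3 s : ℂ) : latX q c1 c2 c3 (s - 1 / 2) =
    (alphaL q * (latX q c1 c2 c3 s - c3) + c3) -
      (qp q (1 / 2) - qp q (-(1 / 2))) / 2 * (c2 * qp q s - c1 * qp q (-s)) := by
  simp only [latX, alphaL, sub_eq_add_neg, neg_add, qp_add, neg_neg]
  ring

theorem eval_U2L_latX (q : ℝ) (c1 c2 c3 s : ℂ) :
    (U2L q c1 c2 c3).eval (latX q c1 c2 c3 s) =
      ((qp q (1 / 2) - qp q (-(1 / 2))) / 2 * (c2 * qp q s - c1 * qp q (-s))) ^ 2 := by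
  have h0 := qp_ne_zero q (1 / 2)
  have h1 := qp_ne_zero q s
  simp only [U2L, latX, alphaL, qp_neg, eval_mul, eval_C, eval_sub, eval_pow, eval_X]
  field_simp
  ring

theorem U2L_ne_zero {q : ℝ} (hq : 0 < q) (hq1 : q ≠ 1) (c1 c2 c3 : ℂ) : U2L q c1 c2 c3 ≠ 0 := by
  refine mul_ne_zero (C_ne_zero.2 (alphaL_sq_sub_one_ne_zero hq hq1)) (Monic.ne_zero ?_)
  monicity!

variable {q : ℝ} {c1 c2 c3 : ℂ} {D S : ℂ[X] → ℂ[X]}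

theorem isDividedDifferencePair (hq : 0 < q) (hq1 : q ≠ 1) (hc : c1 * c2 ≠ 0)
    (hD : ∀ (f : ℂ[X]) (s : ℂ),
      latX q c1 c2 c3 (s + 1/2) ≠ latX q c1 c2 c3 (s - 1/2) →
      (D f).eval (latX q c1 c2 c3 s) =
        (f.eval (latX q c1 c2 c3 (s + 1/2)) - f.eval (latX q c1 c2 c3 (s - 1/2))) /
          (latX q c1 c2 c3 (s + 1/2) - latX q c1 c2 c3 (s - 1/2)))
    (hS : ∀ (f : ℂ[X]) (s : ℂ),
      (S f).eval (latX q c1 c2 c3 s) =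
        (f.eval (latX q c1 c2 c3 (s + 1/2)) + f.eval (latX q c1 c2 c3 (s - 1/2))) / 2) :
    IsDividedDifferencePair q c1 c2 c3 D S := by
  have key : ∀ x, (U2L q c1 c2 c3).eval x ≠ 0 → ∃ δ, δ ≠ 0 ∧ (U2L q c1 c2 c3).eval x = δ ^ 2 ∧
      (∀ f, (D f).eval x = (f.eval ((alphaL q * (x - c3) + c3) + δ) -
        f.eval ((alphaL q * (x - c3) + c3) - δ)) / (2 * δ)) ∧
      (∀ f, (S f).eval x = (f.eval ((alphaL q * (x - c3) + c3) + δ) +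
        f.eval ((alphaL q * (x - c3) + c3) - δ)) / 2) := by
    intro x hx
    obtain ⟨s, rfl⟩ := exists_latX_eq hq hq1 hc c3 x
    rw [eval_U2L_latX] at hx
    have hδ := pow_ne_zero_iff (two_ne_zero) |>.1 hx
    refine ⟨_, hδ, eval_U2L_latX .., fun f => ?_, fun f => ?_⟩
    · rw [hD f s, latX_add_half, latX_sub_half]
      · ring
      · rw [latX_add_half, latX_sub_half]
        intro h
        exact hδ (by linear_combination h / 2)
    · rw [hS f s, latX_add_half, latX_sub_half]
  have ext_off : ∀ F G : ℂ[X], (∀ x, (U2L q c1 c2 c3).eval x ≠ 0 → F.eval x = G.eval x) →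
      F = G := by
    intro F G h
    refine mul_left_cancel₀ (U2L_ne_zero hq hq1 c1 c2 c3) (Polynomial.funext fun x => ?_)
    rw [eval_mul, eval_mul]
    by_cases hx : (U2L q c1 c2 c3).eval x = 0
    · rw [hx, zero_mul, zero_mul]
    · rw [h x hx]
  constructor
  all_goals intros; apply ext_off; intro x hx; obtain ⟨δ, hδ, hU, hDx, hSx⟩ := key x hx
  all_goals simp only [hU, hDx, hSx, eval_add, eval_mul, eval_sub, eval_C, eval_X, eval_zero,
    eval_one]
  all_goals field_simp
  all_goals ring

end Lattice

namespace IsDividedDifferencePair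

variable {q : ℝ} {c1 c2 c3 : ℂ} {D S : ℂ[X] → ℂ[X]}

theorem D_C_mul (h : IsDividedDifferencePair q c1 c2 c3 D S) (a : ℂ) (f : ℂ[X]) :
    D (C a * f) = C a * D f := by
  rw [h.D_mul, h.D_C, h.S_C]
  ring

theorem S_C_mul (h : IsDividedDifferencePair q c1 c2 c3 D S) (a : ℂ) (f : ℂ[X]) :
    S (C a * f) = C a * S f := by
  rw [h.S_mul, h.D_C, h.S_C]
  ring

theorem D_sub (h : IsDividedDifferencePair q c1 c2 c3 D S) (f g : ℂ[X]) :
    D (f - g) = D f - D g := by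
  rw [eq_sub_iff_add_eq, ← h.D_add, sub_add_cancel]

theorem S_sub (h : IsDividedDifferencePair q c1 c2 c3 D S) (f g : ℂ[X]) :
    S (f - g) = S f - S g := by
  rw [eq_sub_iff_add_eq, ← h.S_add, sub_add_cancel]

theorem D_U1 (h : IsDividedDifferencePair q c1 c2 c3 D S) :
    D (U1L q c3) = C (alphaL q ^ 2 - 1) := by
  rw [U1L, h.D_C_mul, h.D_sub, h.D_X, h.D_C]
  ring

theorem S_U1 (h : IsDividedDifferencePair q c1 c2 c3 D S) :
    S (U1L q c3) = C (alphaL q) * U1L q c3 := by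
  rw [U1L, h.S_C_mul, h.S_sub, h.S_X, h.S_C]
  ring

theorem D_U2 (h : IsDividedDifferencePair q c1 c2 c3 D S) :
    D (U2L q c1 c2 c3) = C (2 * alphaL q) * U1L q c3 := by
  rw [U2L, U1L, h.D_C_mul, h.D_sub, pow_two (X - C c3), h.D_mul, h.D_sub, h.S_sub, h.D_X, h.D_C, h.S_X, h.S_C,
    h.D_C]
  simp only [map_mul, map_ofNat]
  ring

theorem S_U2 (h : IsDividedDifferencePair q c1 c2 c3 D S) :
    S (U2L q c1 c2 c3) = C (alphaL q ^ 2) * U2L q c1 c2 c3 + U1L q c3 ^ 2 := by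
  rw [U2L, U1L, h.S_C_mul, h.S_sub, pow_two (X - C c3), h.S_mul, h.D_sub, h.S_sub, h.D_X, h.D_C, h.S_X, h.S_C,
    h.S_C, U2L]
  simp only [map_mul, map_sub, map_pow, map_one]
  ring

theorem S_SX (h : IsDividedDifferencePair q c1 c2 c3 D S) :
    S (S X) = C (alphaL q) * (S X - C c3) + C c3 := by
  simp only [h.S_X, h.S_add, h.S_C_mul, h.S_sub, h.S_C]

theorem D_SX (h : IsDividedDifferencePair q c1 c2 c3 D S) : D (S X) = C (alphaL q) := by
  rw [h.S_X, h.D_add, h.D_C_mul, h.D_sub, h.D_X, h.D_C, sub_zero, mul_one, add_zero]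

theorem DS_and_SS (h : IsDividedDifferencePair q c1 c2 c3 D S) (f : ℂ[X]) :
    D (S f) = C (alphaL q) * S (D f) + U1L q c3 * D (D f) ∧
    S (S f) = U1L q c3 * S (D f) + C (alphaL q) * U2L q c1 c2 c3 * D (D f) + f := by
  have h0 : D 0 = 0 := by simpa using h.D_C 0
  have h0' : S 0 = 0 := by simpa using h.S_C 0
  induction f using Polynomial.induction_on with
  | C a => simp only [h.D_C, h.S_C, h0, h0', mul_zero, add_zero, zero_add, and_self]
  | add f g hf hg =>
    simp only [h.D_add, h.S_add, hf.1, hg.1, hf.2, hg.2]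
    constructor <;> ring
  | monomial n a ih =>
    rw [pow_succ, ← mul_assoc]
    generalize C a * X ^ n = f at ih
    obtain ⟨i1, i2⟩ := ih
    have hX := h.S_X
    simp only [h.D_mul, h.S_mul, h.D_add, h.S_add, h.D_X, h.D_SX, h.S_SX, h.D_U2, h.S_U2,
      mul_one, i1, i2]
    simp only [hX, U1L, map_sub, map_pow, map_one, map_mul, map_ofNat]
    constructor
    · ring
    · rw [U2L]
      simp only [map_sub, map_pow, map_one, map_mul, map_ofNat]
      ring

theorem D_S (h : IsDividedDifferencePair q c1 c2 c3 D S) (f : ℂ[X]) :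
    D (S f) = C (alphaL q) * S (D f) + U1L q c3 * D (D f) := (h.DS_and_SS f).1

theorem S_S (h : IsDividedDifferencePair q c1 c2 c3 D S) (f : ℂ[X]) :
    S (S f) = U1L q c3 * S (D f) + C (alphaL q) * U2L q c1 c2 c3 * D (D f) + f :=
  (h.DS_and_SS f).2

theorem natDegree_S_X_le (h : IsDividedDifferencePair q c1 c2 c3 D S) : (S X).natDegree ≤ 1 := by
  rw [h.S_X]
  compute_degree

theorem coeff_S_X_one (h : IsDividedDifferencePair q c1 c2 c3 D S) :
    (S X).coeff 1 = alphaL q := by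
  rw [h.S_X]
  simp

theorem natDegree_U2L_le (q : ℝ) (c1 c2 c3 : ℂ) : (U2L q c1 c2 c3).natDegree ≤ 2 := by
  rw [U2L]
  compute_degree

theorem coeff_U2L_two (q : ℝ) (c1 c2 c3 : ℂ) :
    (U2L q c1 c2 c3).coeff 2 = alphaL q ^ 2 - 1 := by
  rw [U2L, coeff_C_mul, coeff_sub, pow_two (X - C c3), show (2 : ℕ) = 1 + 1 from rfl,
    coeff_mul_add_eq_of_natDegree_le (by compute_degree) (by compute_degree)]
  simp [coeff_X]

theorem degree_succ (h : IsDividedDifferencePair q c1 c2 c3 D S) (hq : 0 < q) (hq1 : q ≠ 1)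
    (n : ℕ) (f : ℂ[X]) (hf : f.natDegree ≤ n + 1) :
    ((S f).natDegree ≤ n + 1 ∧ (S f).coeff (n + 1) = alphaN q (n + 1) * f.coeff (n + 1)) ∧
    ((D f).natDegree ≤ n ∧ (D f).coeff n = gammaN q (n + 1) * f.coeff (n + 1)) := by
  induction n generalizing f with
  | zero =>
    obtain ⟨a, b, rfl⟩ : ∃ a b, f = C a * X + C b := exists_eq_X_add_C_of_natDegree_le_one hf
    rw [h.S_add, h.D_add, h.D_C_mul, h.S_C_mul, h.D_C, h.S_C, h.D_X]
    refine ⟨⟨?_, ?_⟩, ?_, ?_⟩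
    · have := natDegree_C_mul_le a (S X)
      have := h.natDegree_S_X_le
      exact natDegree_add_le_of_degree_le (by omega) (by simp)
    · simp [coeff_C, h.coeff_S_X_one, alphaN_succ hq hq1]
      ring
    · simp
    · simp [coeff_C, gammaN_succ hq hq1]
  | succ n ih =>
    have hg : f.divX.natDegree ≤ n + 1 := by
      rw [natDegree_divX_eq_natDegree_tsub_one]
      omega
    have hc : f.coeff (n + 1 + 1) = f.divX.coeff (n + 1) := by simp [coeff_divX]
    have hf' : f = X * f.divX + C (f.coeff 0) := (X_mul_divX_add f).symm
    rw [hc]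
    generalize f.divX = g at *
    rw [hf']
    obtain ⟨⟨s1, s2⟩, d1, d2⟩ := ih g hg
    have x1 := h.natDegree_S_X_le
    have x2 := h.coeff_S_X_one
    have u1 := natDegree_U2L_le q c1 c2 c3
    have u2 := coeff_U2L_two q c1 c2 c3
    rw [h.S_add, h.D_add, h.D_mul, h.S_mul, h.D_C, h.S_C, h.D_X, one_mul, one_mul, add_zero]
    refine ⟨⟨?_, ?_⟩, ?_, ?_⟩
    · refine natDegree_add_le_of_degree_le (natDegree_add_le_of_degree_le ?_ ?_) (by simp)
      · exact (natDegree_mul_le_of_le x1 s1).trans (by omega)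
      · exact (natDegree_mul_le_of_le u1 d1).trans (by omega)
    · rw [coeff_add, coeff_add, show n + 1 + 1 = 1 + (n + 1) by ring,
        coeff_mul_add_eq_of_natDegree_le x1 s1, show 1 + (n + 1) = 2 + n by ring,
        coeff_mul_add_eq_of_natDegree_le u1 d1, s2, d2, u2, x2, coeff_C_of_ne_zero (by omega),
        show 2 + n = (n + 1) + 1 by ring, alphaN_succ hq hq1 (n + 1)]
      ring
    · refine natDegree_add_le_of_degree_le s1 ?_
      exact (natDegree_mul_le_of_le x1 d1).trans (by omega)
    · rw [coeff_add, s2, add_comm n 1, coeff_mul_add_eq_of_natDegree_le x1 d1, x2, d2, add_comm 1 n,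
        gammaN_succ hq hq1 (n + 1)]
      ring

theorem natDegree_S_le (h : IsDividedDifferencePair q c1 c2 c3 D S) (hq : 0 < q) (hq1 : q ≠ 1)
    {n : ℕ} {f : ℂ[X]} (hf : f.natDegree ≤ n) : (S f).natDegree ≤ n := by
  cases n with
  | zero =>
    rw [eq_C_of_natDegree_le_zero hf, h.S_C, natDegree_C]
  | succ n => exact (h.degree_succ hq hq1 n f hf).1.1

theorem coeff_S (h : IsDividedDifferencePair q c1 c2 c3 D S) (hq : 0 < q) (hq1 : q ≠ 1)
    {n : ℕ} {f : ℂ[X]} (hf : f.natDegree ≤ n) : (S f).coeff n = alphaN q n * f.coeff n := by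
  cases n with
  | zero =>
    rw [eq_C_of_natDegree_le_zero hf, h.S_C, alphaN_zero, one_mul, coeff_C_zero]
  | succ n => exact (h.degree_succ hq hq1 n f hf).1.2

theorem natDegree_D_le (h : IsDividedDifferencePair q c1 c2 c3 D S) (hq : 0 < q) (hq1 : q ≠ 1)
    {n : ℕ} {f : ℂ[X]} (hf : f.natDegree ≤ n + 1) : (D f).natDegree ≤ n :=
  (h.degree_succ hq hq1 n f hf).2.1

theorem coeff_D (h : IsDividedDifferencePair q c1 c2 c3 D S) (hq : 0 < q) (hq1 : q ≠ 1)
    {n : ℕ} {f : ℂ[X]} (hf : f.natDegree ≤ n + 1) :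
    (D f).coeff n = gammaN q (n + 1) * f.coeff (n + 1) :=
  (h.degree_succ hq hq1 n f hf).2.2

theorem surjective_D (h : IsDividedDifferencePair q c1 c2 c3 D S) (hq : 0 < q) (hq1 : q ≠ 1) :
    Function.Surjective D := by
  suffices H : ∀ n, ∀ g : ℂ[X], g.degree < (n : ℕ) → ∃ f, D f = g from fun g =>
    H (g.natDegree + 1) g (degree_le_natDegree.trans_lt (by exact_mod_cast Nat.lt_succ_self _))
  intro n
  induction n with
  | zero =>
    intro g hg
    have : g = 0 := by simpa using hg
    exact ⟨C 0, by rw [h.D_C, this]⟩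
  | succ n ih =>
    intro g hg
    have hX : (X ^ (n + 1) : ℂ[X]).natDegree ≤ n + 1 := by simp
    have hgn : g.natDegree ≤ n :=
      natDegree_le_iff_coeff_eq_zero.2 ((degree_lt_iff_coeff_zero g (n + 1)).1 hg)
    have hγ := gammaN_succ_ne_zero hq hq1 n
    obtain ⟨f, hf⟩ := ih (g - C (g.coeff n / gammaN q (n + 1)) * D (X ^ (n + 1))) (by
      rw [degree_lt_iff_coeff_zero]
      intro m hm
      rw [coeff_sub, coeff_C_mul]
      obtain rfl | hm := hm.eq_or_lt
      · rw [h.coeff_D hq hq1 hX, coeff_X_pow_self, mul_one, div_mul_cancel₀ _ hγ, sub_self]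
      · rw [coeff_eq_zero_of_natDegree_lt (lt_of_le_of_lt hgn hm),
          coeff_eq_zero_of_natDegree_lt (lt_of_le_of_lt (h.natDegree_D_le hq hq1 hX) hm)]
        ring)
    refine ⟨f + C (g.coeff n / gammaN q (n + 1)) * X ^ (n + 1), ?_⟩
    rw [h.D_add, h.D_C_mul, hf, sub_add_cancel]

theorem natDegree_pearson_le (h : IsDividedDifferencePair q c1 c2 c3 D S) (hq : 0 < q)
    (hq1 : q ≠ 1) {φ ψ : ℂ[X]} (hφ : φ.natDegree ≤ 2) (hψ : ψ.natDegree ≤ 1)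
    {n : ℕ} {f : ℂ[X]} (hf : f.natDegree ≤ n) : (φ * D f + ψ * S f).natDegree ≤ n + 1 := by
  refine natDegree_add_le_of_degree_le ?_ ?_
  · cases n with
    | zero =>
      rw [eq_C_of_natDegree_le_zero hf, h.D_C]
      simp
    | succ n =>
      exact (natDegree_mul_le_of_le hφ (h.natDegree_D_le hq hq1 hf)).trans (by omega)
  · exact (natDegree_mul_le_of_le hψ (h.natDegree_S_le hq hq1 hf)).trans (by omega)

theorem coeff_pearson (h : IsDividedDifferencePair q c1 c2 c3 D S) (hq : 0 < q)
    (hq1 : q ≠ 1) {φ ψ : ℂ[X]} (hφ : φ.natDegree ≤ 2) (hψ : ψ.natDegree ≤ 1)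
    {n : ℕ} {f : ℂ[X]} (hf : f.natDegree ≤ n) : (φ * D f + ψ * S f).coeff (n + 1) =
      (gammaN q n * φ.coeff 2 + alphaN q n * ψ.coeff 1) * f.coeff n := by
  rw [coeff_add, add_comm n 1, coeff_mul_add_eq_of_natDegree_le hψ (h.natDegree_S_le hq hq1 hf),
    h.coeff_S hq hq1 hf]
  have : (φ * D f).coeff (1 + n) = φ.coeff 2 * (gammaN q n * f.coeff n) := by
    cases n with
    | zero =>
      rw [eq_C_of_natDegree_le_zero hf, h.D_C]
      simp
    | succ n =>
      rw [show 1 + (n + 1) = 2 + n by ring,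
        coeff_mul_add_eq_of_natDegree_le hφ (h.natDegree_D_le hq hq1 hf), h.coeff_D hq hq1 hf]
  rw [this]
  ring

theorem sq_S_sub_ne_zero (h : IsDividedDifferencePair q c1 c2 c3 D S) (hq : 0 < q)
    (hq1 : q ≠ 1) {f : ℂ[X]} (hf : f ≠ 0) : (S f) ^ 2 - U2L q c1 c2 c3 * (D f) ^ 2 ≠ 0 := by
  have hN : ∀ n, alphaN q n ^ 2 - (alphaL q ^ 2 - 1) * gammaN q n ^ 2 = 1 := by
    intro n
    induction n with
    | zero => simp
    | succ n ih =>
      rw [alphaN_succ hq hq1, gammaN_succ hq hq1]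
      linear_combination ih
  obtain ⟨n, hn⟩ : ∃ n, f.natDegree = n := ⟨_, rfl⟩
  have hs1 := h.natDegree_S_le hq hq1 hn.le
  have hs2 := h.coeff_S hq hq1 hn.le
  suffices H : ((S f) ^ 2 - U2L q c1 c2 c3 * (D f) ^ 2).coeff (n + n) = f.coeff n ^ 2 by
    intro h0
    rw [h0, coeff_zero, ← hn] at H
    exact hf (leadingCoeff_eq_zero.1 (pow_eq_zero_iff two_ne_zero |>.1 H.symm))
  rw [coeff_sub, pow_two (S f), coeff_mul_add_eq_of_natDegree_le hs1 hs1, hs2]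
  cases n with
  | zero =>
    rw [eq_C_of_natDegree_le_zero hn.le, h.D_C]
    simp
    ring
  | succ n =>
    have hd1 := h.natDegree_D_le hq hq1 hn.le
    have hd2 := h.coeff_D hq hq1 hn.le
    rw [show n + 1 + (n + 1) = 2 + (n + n) by ring, pow_two (D f),
      coeff_mul_add_eq_of_natDegree_le (natDegree_U2L_le q c1 c2 c3)
        (natDegree_mul_le_of_le hd1 hd1), coeff_mul_add_eq_of_natDegree_le hd1 hd1, hd2,
      coeff_U2L_two]
    linear_combination (f.coeff (n + 1)) ^ 2 * hN (n + 1)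

end IsDividedDifferencePair

namespace IsMonicOPS

variable {v : ℂ[X] →ₗ[ℂ] ℂ} {P : ℕ → ℂ[X]}

theorem coeff_self (hP : IsMonicOPS v P) (n : ℕ) : (P n).coeff n = 1 := by
  have := (hP.monic n).coeff_natDegree
  rwa [hP.natDegree_eq] at this

theorem apply_mul_of_degree_lt (hP : IsMonicOPS v P) {m n : ℕ} (hmn : m ≤ n) {f : ℂ[X]}
    (hf : f.degree < (m : ℕ)) : v (P n * f) = 0 := by
  induction m generalizing f with
  | zero =>
    have : f = 0 := by simpa using hf
    simp [this]
  | succ m ih =>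
    have hfm : f.natDegree ≤ m := 
      natDegree_le_iff_coeff_eq_zero.2 ((degree_lt_iff_coeff_zero f (m + 1)).1 hf)
    have hlt : (f - C (f.coeff m) * P m).degree < (m : ℕ) := by
      rw [degree_lt_iff_coeff_zero]
      intro k hk
      rw [coeff_sub, coeff_C_mul]
      obtain rfl | hk := hk.eq_or_lt
      · rw [hP.coeff_self, mul_one, sub_self]
      · rw [coeff_eq_zero_of_natDegree_lt (lt_of_le_of_lt hfm hk),
          coeff_eq_zero_of_natDegree_lt ((hP.natDegree_eq m).trans_lt hk)]
        ring
    have h1 := ih (by omega) hlt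
    have h2 := hP.ortho n m (by omega)
    have h3 : P n * f = P n * (f - C (f.coeff m) * P m) + f.coeff m • (P n * P m) := by
      rw [smul_eq_C_mul]
      ring
    rw [h3, map_add, map_smul, h1, h2, smul_zero, add_zero]

theorem apply_mul_of_natDegree_le (hP : IsMonicOPS v P) {n : ℕ} {f : ℂ[X]}
    (hf : f.natDegree ≤ n) : v (P n * f) = f.coeff n * v (P n * P n) := by
  have hlt : (f - C (f.coeff n) * P n).degree < (n : ℕ) := by
    rw [degree_lt_iff_coeff_zero]
    intro k hk
    rw [coeff_sub, coeff_C_mul]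
    obtain rfl | hk := hk.eq_or_lt
    · rw [hP.coeff_self, mul_one, sub_self]
    · rw [coeff_eq_zero_of_natDegree_lt (lt_of_le_of_lt hf hk),
        coeff_eq_zero_of_natDegree_lt ((hP.natDegree_eq n).trans_lt hk)]
      ring
  have h3 : P n * f = P n * (f - C (f.coeff n) * P n) + f.coeff n • (P n * P n) := by
    rw [smul_eq_C_mul]
    ring
  rw [h3, map_add, map_smul, hP.apply_mul_of_degree_lt le_rfl hlt, zero_add, smul_eq_mul]

theorem eq_zero_of_apply_mul (hP : IsMonicOPS v P) {n : ℕ} {f : ℂ[X]} (hf : f.natDegree ≤ n)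
    (h : ∀ m ≤ n, v (P m * f) = 0) : f = 0 := by
  by_contra h0
  have h1 := h _ hf
  rw [hP.apply_mul_of_natDegree_le le_rfl] at h1
  exact mul_ne_zero (leadingCoeff_ne_zero.2 h0) (hP.norm_ne _) h1

end IsMonicOPS

namespace IsDividedDifferencePair

variable {q : ℝ} {c1 c2 c3 : ℂ} {D S : ℂ[X] → ℂ[X]} {v w : ℂ[X] →ₗ[ℂ] ℂ} {φ ψ : ℂ[X]}

theorem apply_D_mul (h : IsDividedDifferencePair q c1 c2 c3 D S)
    (hv : ∀ f, v (φ * D f) + v (ψ * S f) = 0)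
    (hw : ∀ f, w f = -(v (U2L q c1 c2 c3 * ψ * D f)) - v (φ * S f)) (f g : ℂ[X]) :
    w (D f * g) = alphaL q * v (f * (φ * D g + ψ * S g)) := by
  have e : alphaL q • (f * (φ * D g + ψ * S g)) +
      U2L q c1 c2 c3 * ψ * D (D f * g) + φ * S (D f * g) =
      φ * D (C (alphaL q) * (g * S f) - U1L q c3 * (D f * g)) +
      ψ * S (C (alphaL q) * (g * S f) - U1L q c3 * (D f * g)) := by
    simp only [smul_eq_C_mul, h.D_sub, h.S_sub, h.D_C_mul, h.S_C_mul, h.D_mul, h.S_mul, h.D_U1,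
      h.S_U1, h.D_S, h.S_S, map_sub, map_pow, map_one]
    ring
  have e' := congrArg v e
  simp only [map_add, hv, map_smul, smul_eq_mul] at e'
  rw [hw]
  linear_combination -e'

theorem pearson_next (h : IsDividedDifferencePair q c1 c2 c3 D S) (hq : 0 < q) (hq1 : q ≠ 1)
    (hψ : ψ.natDegree ≤ 1)
    (hv : ∀ f, v (φ * D f) + v (ψ * S f) = 0)
    (hw : ∀ f, w f = -(v (U2L q c1 c2 c3 * ψ * D f)) - v (φ * S f)) (f : ℂ[X]) :
    w ((S φ + U1L q c3 * S ψ + C (alphaL q) * U2L q c1 c2 c3 * D ψ) * D f) +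
      w ((D φ + C (alphaL q) * S ψ + U1L q c3 * D ψ) * S f) = 0 := by
  obtain ⟨f, rfl⟩ := h.surjective_D hq hq1 f
  obtain ⟨d, e, rfl⟩ := exists_eq_X_add_C_of_natDegree_le_one hψ
  have hDψ : D (C d * X + C e) = C d := by
    rw [h.D_add, h.D_C_mul, h.D_X, h.D_C, mul_one, add_zero]
  set ψ := C d * X + C e with hψd
  have e1 : (S φ + U1L q c3 * S ψ + C (alphaL q) * U2L q c1 c2 c3 * D ψ) * D (D f) +
      (D φ + C (alphaL q) * S ψ + U1L q c3 * D ψ) * S (D f) =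
      D (φ * D f + ψ * S f) * 1 - d • f := by
    rw [smul_eq_C_mul, h.D_add (φ * D f), h.D_mul φ, h.D_mul ψ, hDψ, h.D_S, h.S_S]
    ring
  rw [← map_add, e1, map_sub, map_smul, h.apply_D_mul hv hw, hw, ← C_1, h.D_C, h.S_C]
  have e2 : d • (U2L q c1 c2 c3 * ψ * D f) + d • (φ * S f) +
      alphaL q • ((φ * D f + ψ * S f) * (φ * 0 + ψ * C 1)) =
      φ * D ((C d * X + C (alphaL q * e - d * (1 - alphaL q) * c3)) * f) +
      ψ * S ((C d * X + C (alphaL q * e - d * (1 - alphaL q) * c3)) * f) := by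
    have hs : S (C d * X + C (alphaL q * e - d * (1 - alphaL q) * c3)) = C (alphaL q) * ψ := by
      rw [h.S_add, h.S_C_mul, h.S_X, h.S_C, hψd]
      simp only [map_sub, map_mul, map_one]
      ring
    have hd : D (C d * X + C (alphaL q * e - d * (1 - alphaL q) * c3)) = C d := by
      rw [h.D_add, h.D_C_mul, h.D_X, h.D_C, mul_one, add_zero]
    rw [h.D_mul, h.S_mul, hs, hd]
    simp only [smul_eq_C_mul, map_one]
    ring
  have e3 := congrArg v e2
  simp only [map_add, hv, map_smul, smul_eq_mul] at e3
  simp only [smul_eq_mul]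
  linear_combination e3

variable {P : ℕ → ℂ[X]}

theorem admissible (h : IsDividedDifferencePair q c1 c2 c3 D S) (hq : 0 < q) (hq1 : q ≠ 1)
    (hP : IsMonicOPS v P) (hφ : φ.natDegree ≤ 2) (hψ : ψ.natDegree ≤ 1)
    (hne : ¬(φ = 0 ∧ ψ = 0))
    (hv : ∀ f, v (φ * D f) + v (ψ * S f) = 0)
    (hw : ∀ f, w f = -(v (U2L q c1 c2 c3 * ψ * D f)) - v (φ * S f)) (n : ℕ) :
    gammaN q n * φ.coeff 2 + alphaN q n * ψ.coeff 1 ≠ 0 := by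
  intro h0
  set Q := D (P (n + 1)) with hQ
  have hPd := (hP.natDegree_eq (n + 1)).le
  have hQd : Q.natDegree ≤ n := h.natDegree_D_le hq hq1 hPd
  have hQ0 : Q ≠ 0 := by
    intro h1
    have := h.coeff_D hq hq1 hPd
    rw [← hQ, h1, hP.coeff_self, mul_one, coeff_zero] at this
    exact gammaN_succ_ne_zero hq hq1 n this.symm
  have hLd : (φ * D Q + ψ * S Q).natDegree ≤ n := by
    have h1 := h.natDegree_pearson_le hq hq1 hφ hψ hQd
    have h2 := h.coeff_pearson hq hq1 hφ hψ hQd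
    rw [h0, zero_mul] at h2
    rw [natDegree_le_iff_coeff_eq_zero]
    intro m hm
    obtain rfl | hm := (Nat.succ_le_of_lt hm).eq_or_lt
    · exact h2
    · exact coeff_eq_zero_of_natDegree_lt (lt_of_le_of_lt h1 hm)
  have hL : φ * D Q + ψ * S Q = 0 := by
    refine hP.eq_zero_of_apply_mul hLd fun m hm => ?_
    have h1 := h.apply_D_mul hv hw (P m) Q
    rw [hQ, mul_comm, h.apply_D_mul hv hw] at h1
    have h2 := mul_left_cancel₀ (alphaL_ne_zero q) h1
    rw [← hQ] at h2
    rw [← h2]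
    refine hP.apply_mul_of_degree_lt le_rfl (lt_of_le_of_lt (b := (m : WithBot ℕ)) ?_
      (by exact_mod_cast Nat.lt_succ_of_le hm))
    refine natDegree_le_iff_degree_le.1 ?_
    cases m with
    | zero =>
      have : P 0 = 1 := eq_one_of_monic_natDegree_zero (hP.monic 0) (hP.natDegree_eq 0)
      rw [this, ← C_1, h.D_C, ← C_0, h.D_C, h.S_C]
      simp
    | succ m =>
      exact h.natDegree_pearson_le hq hq1 hφ hψ
        (h.natDegree_D_le hq hq1 (hP.natDegree_eq _).le)
  have hL' : ψ * U2L q c1 c2 c3 * D Q + φ * S Q = 0 := by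
    refine hP.eq_zero_of_apply_mul le_rfl fun m _ => ?_
    obtain ⟨g, hg⟩ := h.surjective_D hq hq1 (P m)
    have e : P m * (ψ * U2L q c1 c2 c3 * D Q + φ * S Q) =
        φ * D (Q * g) + ψ * S (Q * g) := by
      rw [← hg, h.D_mul, h.S_mul]
      linear_combination (-S g) * hL
    rw [e, map_add, hv]
  have hdet : (S Q) ^ 2 - U2L q c1 c2 c3 * (D Q) ^ 2 ≠ 0 :=
    h.sq_S_sub_ne_zero hq hq1 hQ0
  refine hne ⟨?_, ?_⟩
  · refine (mul_eq_zero.1 ?_).resolve_right hdet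
    linear_combination S Q * hL' - U2L q c1 c2 c3 * D Q * hL
  · refine (mul_eq_zero.1 ?_).resolve_right hdet
    linear_combination S Q * hL - D Q * hL'

theorem isMonicOPS_next (h : IsDividedDifferencePair q c1 c2 c3 D S) (hq : 0 < q) (hq1 : q ≠ 1)
    (hP : IsMonicOPS v P) (hφ : φ.natDegree ≤ 2) (hψ : ψ.natDegree ≤ 1)
    (hne : ¬(φ = 0 ∧ ψ = 0))
    (hv : ∀ f, v (φ * D f) + v (ψ * S f) = 0)
    (hw : ∀ f, w f = -(v (U2L q c1 c2 c3 * ψ * D f)) - v (φ * S f)) :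
    IsMonicOPS w (fun n => C (gammaN q (n + 1))⁻¹ * D (P (n + 1))) := by
  have hγ := gammaN_succ_ne_zero hq hq1
  have hd : ∀ n, (C (gammaN q (n + 1))⁻¹ * D (P (n + 1))).natDegree ≤ n := fun n =>
    (natDegree_C_mul_le _ _).trans (h.natDegree_D_le hq hq1 (hP.natDegree_eq _).le)
  have hc : ∀ n, (C (gammaN q (n + 1))⁻¹ * D (P (n + 1))).coeff n = 1 := fun n => by
    rw [coeff_C_mul, h.coeff_D hq hq1 (hP.natDegree_eq _).le, hP.coeff_self, mul_one,
      inv_mul_cancel₀ (hγ n)]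
  have hwD : ∀ n g, w (C (gammaN q (n + 1))⁻¹ * D (P (n + 1)) * g) =
      (gammaN q (n + 1))⁻¹ * (alphaL q * v (P (n + 1) * (φ * D g + ψ * S g))) := fun n g => by
    rw [← h.apply_D_mul hv hw, mul_assoc, ← smul_eq_C_mul, map_smul, smul_eq_mul]
  have hlt : ∀ n m, m < n → w (C (gammaN q (n + 1))⁻¹ * D (P (n + 1)) *
      (C (gammaN q (m + 1))⁻¹ * D (P (m + 1)))) = 0 := fun n m hmn => by
    rw [hwD, hP.apply_mul_of_degree_lt le_rfl, mul_zero, mul_zero]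
    exact lt_of_le_of_lt (natDegree_le_iff_degree_le.1
      (h.natDegree_pearson_le hq hq1 hφ hψ (hd m))) (by exact_mod_cast Nat.succ_lt_succ hmn)
  refine ⟨fun n => monic_of_natDegree_le_of_coeff_eq_one n (hd n) (hc n), fun n => ?_,
    fun n m hnm => ?_, fun n => ?_⟩
  · exact natDegree_eq_of_le_of_coeff_ne_zero (hd n) (by rw [hc]; exact one_ne_zero)
  · obtain hlt' | hlt' := hnm.lt_or_gt
    · rw [mul_comm]
      exact hlt _ _ hlt'
    · exact hlt _ _ hlt'
  · rw [hwD, hP.apply_mul_of_natDegree_le (h.natDegree_pearson_le hq hq1 hφ hψ (hd n)),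
      h.coeff_pearson hq hq1 hφ hψ (hd n), hc, mul_one]
    exact mul_ne_zero (inv_ne_zero (hγ n)) (mul_ne_zero (alphaL_ne_zero q)
      (mul_ne_zero (h.admissible hq hq1 hP hφ hψ hne hv hw n) (hP.norm_ne _)))

theorem natDegree_pearson_coefficients_next_le (h : IsDividedDifferencePair q c1 c2 c3 D S)
    (hq : 0 < q) (hq1 : q ≠ 1) (hφ : φ.natDegree ≤ 2) (hψ : ψ.natDegree ≤ 1) :
    (S φ + U1L q c3 * S ψ + C (alphaL q) * U2L q c1 c2 c3 * D ψ).natDegree ≤ 2 ∧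
    (D φ + C (alphaL q) * S ψ + U1L q c3 * D ψ).natDegree ≤ 1 ∧
    (D φ + C (alphaL q) * S ψ + U1L q c3 * D ψ).coeff 1 =
      gammaN q 2 * φ.coeff 2 + alphaN q 2 * ψ.coeff 1 := by
  have hU1 : (U1L q c3).natDegree ≤ 1 := by
    rw [U1L]
    compute_degree
  have hU1c : (U1L q c3).coeff 1 = alphaL q ^ 2 - 1 := by
    rw [U1L, coeff_C_mul]
    simp
  have a1 := h.natDegree_S_le hq hq1 hφ
  have a2 := h.natDegree_S_le hq hq1 hψ
  have a3 := h.natDegree_D_le hq hq1 hφ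
  have a4 := h.natDegree_D_le hq hq1 (n := 0) hψ
  refine ⟨?_, ?_, ?_⟩
  · refine natDegree_add_le_of_degree_le (natDegree_add_le_of_degree_le a1 ?_) ?_
    · exact natDegree_mul_le_of_le hU1 a2
    · exact natDegree_mul_le_of_le
        ((natDegree_C_mul_le _ _).trans (natDegree_U2L_le q c1 c2 c3)) a4
  · refine natDegree_add_le_of_degree_le (natDegree_add_le_of_degree_le a3 ?_) ?_
    · exact (natDegree_C_mul_le _ _).trans a2
    · exact natDegree_mul_le_of_le hU1 a4
  · have b := coeff_mul_add_eq_of_natDegree_le hU1 a4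
    have b4 := h.coeff_D hq hq1 (n := 0) hψ
    rw [add_zero] at b
    rw [coeff_add, coeff_add, coeff_C_mul, b, h.coeff_D hq hq1 hφ, h.coeff_S hq hq1 hψ, b4, hU1c]
    have g1 : gammaN q 1 = 1 := by rw [gammaN_succ hq hq1, alphaN_zero, gammaN_zero]; ring
    rw [zero_add, g1, alphaN_succ hq hq1 1, g1]
    ring

end IsDividedDifferencePair

theorem stmt_9 (q : ℝ) (hq : 0 < q) (hq1 : q ≠ 1) (c1 c2 c3 : ℂ) (hc : c1 * c2 ≠ 0)
    (Dx Sx : Polynomial ℂ → Polynomial ℂ)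
    (hDx : ∀ (f : Polynomial ℂ) (s : ℂ),
      latX q c1 c2 c3 (s + 1/2) ≠ latX q c1 c2 c3 (s - 1/2) →
      (Dx f).eval (latX q c1 c2 c3 s) =
        (f.eval (latX q c1 c2 c3 (s + 1/2)) - f.eval (latX q c1 c2 c3 (s - 1/2))) /
          (latX q c1 c2 c3 (s + 1/2) - latX q c1 c2 c3 (s - 1/2)))
    (hSx : ∀ (f : Polynomial ℂ) (s : ℂ),
      (Sx f).eval (latX q c1 c2 c3 s) =
        (f.eval (latX q c1 c2 c3 (s + 1/2)) + f.eval (latX q c1 c2 c3 (s - 1/2))) / 2)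
    (u : Polynomial ℂ →ₗ[ℂ] ℂ)
    (P : ℕ → Polynomial ℂ)
    (hPm : ∀ n, (P n).Monic) (hPd : ∀ n, (P n).natDegree = n)
    (hPo : ∀ n m, n ≠ m → u (P n * P m) = 0)
    (hPn : ∀ n, u (P n * P n) ≠ 0)
    (φ ψ : Polynomial ℂ) (hφ : φ.degree ≤ 2) (hψ : ψ.degree ≤ 1)
    (hne : ¬(φ = 0 ∧ ψ = 0))
    (hPearson : ∀ f : Polynomial ℂ, u (φ * Dx f) + u (ψ * Sx f) = 0)
    (Phi Psi : ℕ → Polynomial ℂ)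
    (hPhi0 : Phi 0 = φ) (hPsi0 : Psi 0 = ψ)
    (hPhiRec : ∀ k, Phi (k + 1) =
      Sx (Phi k) + U1L q c3 * Sx (Psi k) + C (alphaL q) * U2L q c1 c2 c3 * Dx (Psi k))
    (hPsiRec : ∀ k, Psi (k + 1) =
      Dx (Phi k) + C (alphaL q) * Sx (Psi k) + U1L q c3 * Dx (Psi k))
    (U : ℕ → (Polynomial ℂ →ₗ[ℂ] ℂ))
    (hU0 : U 0 = u)
    (hURec : ∀ k (f : Polynomial ℂ),
      U (k + 1) f = -(U k (U2L q c1 c2 c3 * Psi k * Dx f)) - U k (Phi k * Sx f)) :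
    (∀ n : ℕ,
      gammaN q n / 2 * ((derivative (derivative φ)).coeff 0) +
        alphaN q n * ((derivative ψ).coeff 0) ≠ 0) ∧
    (∀ k : ℕ, 1 ≤ k →
      (∀ n : ℕ, (C (gammaFact q n / gammaFact q (n + k)) * Dx^[k] (P (n + k))).Monic) ∧
      (∀ n m : ℕ, n ≠ m →
        U k ((C (gammaFact q n / gammaFact q (n + k)) * Dx^[k] (P (n + k))) *
          (C (gammaFact q m / gammaFact q (m + k)) * Dx^[k] (P (m + k)))) = 0) ∧
      (∀ n : ℕ,
        U k ((C (gammaFact q n / gammaFact q (n + k)) * Dx^[k] (P (n + k))) ^ 2) ≠ 0)) := by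
  have h := isDividedDifferencePair hq hq1 hc hDx hSx
  have hφ' := natDegree_le_of_degree_le hφ
  have hψ' := natDegree_le_of_degree_le hψ
  subst hPhi0 hPsi0
  have main : ∀ k, IsMonicOPS (U k)
      (fun n => C (gammaFact q n / gammaFact q (n + k)) * Dx^[k] (P (n + k))) ∧
      (Phi k).natDegree ≤ 2 ∧ (Psi k).natDegree ≤ 1 ∧ ¬(Phi k = 0 ∧ Psi k = 0) ∧
      ∀ f, U k (Phi k * Dx f) + U k (Psi k * Sx f) = 0 := by
    intro k
    induction k with
    | zero =>
      have hself : (fun n => C (gammaFact q n / gammaFact q (n + 0)) * Dx^[0] (P (n + 0))) = P := by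
        funext n
        simp [div_self (gammaFact_ne_zero hq hq1 n)]
      rw [hself, hU0]
      exact ⟨⟨hPm, hPd, hPo, hPn⟩, hφ', hψ', hne, hPearson⟩
    | succ k ih =>
      obtain ⟨hP, hφk, hψk, hnek, hv⟩ := ih
      have hnext := h.natDegree_pearson_coefficients_next_le hq hq1 hφk hψk
      rw [← hPhiRec, ← hPsiRec] at hnext
      obtain ⟨hφk', hψk', hcoeff⟩ := hnext
      have hshift : (fun n => C (gammaFact q n / gammaFact q (n + (k + 1))) *
          Dx^[k + 1] (P (n + (k + 1)))) = fun n => C (gammaN q (n + 1))⁻¹ *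
          Dx (C (gammaFact q (n + 1) / gammaFact q (n + 1 + k)) * Dx^[k] (P (n + 1 + k))) := by
        funext n
        rw [h.D_C_mul, ← mul_assoc, ← C_mul, Function.iterate_succ_apply',
          show n + 1 + k = n + (k + 1) by ring, gammaFact]
        have := gammaN_succ_ne_zero hq hq1 n
        have := gammaFact_ne_zero hq hq1 (n + (k + 1))
        congr 2
        field_simp
      have hP' := h.isMonicOPS_next hq hq1 hP hφk hψk hnek hv (hURec k)
      rw [hshift]
      refine ⟨hP', hφk', hψk', ?_, ?_⟩
      · rintro ⟨-, h0⟩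
        rw [h0, coeff_zero] at hcoeff
        exact h.admissible hq hq1 hP hφk hψk hnek hv (hURec k) 2 hcoeff.symm
      · rw [hPhiRec, hPsiRec]
        exact h.pearson_next hq hq1 hψk hv (hURec k)
  refine ⟨fun n => ?_, fun k _ => ?_⟩
  · obtain ⟨hP, -⟩ := main 0
    have hv := hPearson
    rw [← hU0] at hv
    have hd := h.admissible hq hq1 hP hφ' hψ' hne hv (hURec 0) n
    rw [coeff_derivative, coeff_derivative, coeff_derivative]
    convert hd using 1
    norm_num
    ring
  · obtain ⟨hP, -⟩ := main k
    refine ⟨hP.monic, hP.ortho, fun n => ?_⟩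
    rw [pow_two]
    exact hP.norm_ne n
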